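/- Let G=(V,E) be a finite simple graph with vertex weights w: V → ℝ≥0 and let W ≥ 0. Suppose S ⊆ V satisfies w(S) ≥ W and deg(S) ≤ deg(U) for every U ⊆ V with w(U) ≥ W (i.e., S minimizes the degree sum among all subsets of weight at least W). Then for every U ⊆ V with w(U) ≥ W, t(S) ≤ 2·t(U); that is, S is a 2-approximate solution to the Fixed cost minimum edge cover problem. -/

import Mathlib

open Finset

/-- The set of edges of `G` touching `U`, i.e. with at least one endpoint in `U`. -/
def touchingEdges {V : Type*} [Fintype V] [DecidableEq V] (G : SimpleGraph V)
    [DecidableRel G.Adj] (U : Finset V) : Finset (Sym2 V) :=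
  G.edgeFinset.filter (fun e => ∃ v ∈ U, v ∈ e)

section

variable {V : Type*} [Fintype V] [DecidableEq V] (G : SimpleGraph V) [DecidableRel G.Adj]

theorem touchingEdges_eq_biUnion (U : Finset V) :
    touchingEdges G U = U.biUnion fun v => G.incidenceFinset v := by
  ext e
  simp only [touchingEdges, mem_filter, mem_biUnion, SimpleGraph.mem_incidenceFinset,
    SimpleGraph.incidenceSet, SimpleGraph.mem_edgeFinset, Set.mem_sep_iff]
  tauto

theorem card_touchingEdges_le_sum_degree (U : Finset V) :
    (touchingEdges G U).card ≤ ∑ v ∈ U, G.degree v := by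
  simpa [touchingEdges_eq_biUnion] using
    card_biUnion_le (s := U) (t := fun v => G.incidenceFinset v)

theorem sum_degree_le_two_mul_card_touchingEdges (U : Finset V) :
    ∑ v ∈ U, G.degree v ≤ 2 * (touchingEdges G U).card := by
  have hdeg : ∀ v ∈ U, G.degree v = ((touchingEdges G U).filter fun e => v ∈ e).card := by
    intro v hv
    rw [← SimpleGraph.card_incidenceFinset_eq_degree]
    congr 1
    ext e
    simp only [touchingEdges, mem_filter, SimpleGraph.mem_incidenceFinset,
      SimpleGraph.incidenceSet, SimpleGraph.mem_edgeFinset, Set.mem_sep_iff]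
    exact ⟨fun h => ⟨⟨h.1, v, hv, h.2⟩, h.2⟩, fun h => ⟨h.1.1, h.2⟩⟩
  have hcount : ∀ e ∈ touchingEdges G U, (U.filter fun v => v ∈ e).card ≤ 2 := by
    intro e _
    induction e with | _ a b
    refine (card_le_card (t := {a, b}) fun v hv => ?_).trans card_le_two
    simpa using (mem_filter.mp hv).2
  calc ∑ v ∈ U, G.degree v
      = ∑ v ∈ U, ((touchingEdges G U).filter fun e => v ∈ e).card := sum_congr rfl hdeg
    _ = ∑ e ∈ touchingEdges G U, (U.filter fun v => v ∈ e).card :=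
        sum_card_bipartiteAbove_eq_sum_card_bipartiteBelow (fun (v : V) (e : Sym2 V) => v ∈ e)
    _ ≤ 2 * (touchingEdges G U).card := by
        simpa [mul_comm] using sum_le_card_nsmul _ _ 2 hcount

end

/-- If `S` has weight at least `W` and minimizes the degree sum among all subsets of
weight at least `W`, then `t(S) ≤ 2·t(U)` for every subset `U` of weight at least `W`;
i.e. `S` is a 2-approximate solution to the Fixed cost minimum edge cover problem. -/
theorem minDegSum_two_approx_FCEC
    {V : Type*} [Fintype V] [DecidableEq V] (G : SimpleGraph V) [DecidableRel G.Adj]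
    (w : V → ℝ) (hw : ∀ v, 0 ≤ w v) (W : ℝ) (hW : 0 ≤ W)
    (S : Finset V) (hSw : W ≤ ∑ v ∈ S, w v)
    (hSmin : ∀ U : Finset V, W ≤ (∑ v ∈ U, w v) →
      (∑ v ∈ S, G.degree v) ≤ ∑ v ∈ U, G.degree v) :
    ∀ U : Finset V, W ≤ (∑ v ∈ U, w v) →
      (touchingEdges G S).card ≤ 2 * (touchingEdges G U).card := by
  intro U hU
  exact (card_touchingEdges_le_sum_degree G S).trans
    ((hSmin U hU).trans (sum_degree_le_two_mul_card_touchingEdges G U))
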